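/- Let χ be a child distribution with all moments finite and with more than one point of support, let h be a threshold function, and let Ψ be the automaton distribution map of (χ,h). Then the following are equivalent: (i) Ψ'(0) = 1 and Ψ''(0) ≤ 0; (ii) there exist child distributions χ_1, χ_2, χ_3, …, each with all moments finite, such that Σ_{k=1}^{∞} k^n·|χ_j(k) − χ(k)| → 0 as j → ∞ for every n ≥ 0, together with points x_j ∈ (0,1) satisfying Ψ_j(x_j) = x_j, Ψ_j'(x_j) ≤ 1, and x_j → 0, where Ψ_j is the automaton distribution map of (χ_j,h). (By the interpretability criterion, a fixed point x_0 ∈ (0,1) of (π,h) admits an interpretation if and only if Ψ_π'(x_0) ≤ 1, so condition (ii) is the paper's definition of criticality of the recursive tree system (χ,h).) -/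

import Mathlib

/-- `B≥_{n,k}(x) = Σ_{j=k}^{n} C(n,j)·x^j·(1−x)^{n−j}`. -/
noncomputable def Bge (n k : ℕ) (x : ℝ) : ℝ :=
  ∑ j ∈ Finset.Icc k n, (n.choose j : ℝ) * x ^ j * (1 - x) ^ (n - j)

/-- A child distribution: nonnegative, summable, total mass one. -/
def IsChildDist (χ : ℕ → ℝ) : Prop :=
  (∀ n, 0 ≤ χ n) ∧ Summable χ ∧ (∑' n, χ n) = 1

/-- The automaton distribution map of a recursive tree system `(χ, h)`. -/
noncomputable def Psi (χ : ℕ → ℝ) (h : ℕ → ℕ) (x : ℝ) : ℝ :=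
  ∑' n, χ n * Bge n (h n) x

/-- `Ψ` is `m`-concordant: the first `m` derivatives of `Ψ` at `0` (within `[0,1]`)
match those of the identity, i.e. `Ψ'(0) = 1` and `Ψ^{(k)}(0) = 0` for `2 ≤ k ≤ m`.
(For `m = 0` the condition is vacuous.) -/
def Concordant (m : ℕ) (Ψ : ℝ → ℝ) : Prop :=
  (1 ≤ m → iteratedDerivWithin 1 Ψ (Set.Icc (0 : ℝ) 1) 0 = 1) ∧
  ∀ k, 2 ≤ k → k ≤ m → iteratedDerivWithin k Ψ (Set.Icc (0 : ℝ) 1) 0 = 0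

open Polynomial Set Filter Topology

theorem bernsteinPolynomial_eval_nonneg (n j : ℕ) {x : ℝ} (hx : x ∈ Icc (0 : ℝ) 1) :
    0 ≤ (bernsteinPolynomial ℝ n j).eval x := by
  have h0 := hx.1
  have h1 : 0 ≤ 1 - x := sub_nonneg.2 hx.2
  simp only [bernsteinPolynomial, eval_mul, eval_pow, eval_sub, eval_X, eval_one, eval_natCast]
  positivity

theorem bernsteinPolynomial_eval_le_one (n j : ℕ) {x : ℝ} (hx : x ∈ Icc (0 : ℝ) 1) :
    (bernsteinPolynomial ℝ n j).eval x ≤ 1 := by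
  rcases lt_or_ge n j with hj | hj
  · simp [bernsteinPolynomial.eq_zero_of_lt ℝ hj]
  · have hsum := congrArg (eval x) (bernsteinPolynomial.sum ℝ n)
    rw [eval_finsetSum, eval_one] at hsum
    rw [← hsum]
    exact Finset.single_le_sum (f := fun ν => (bernsteinPolynomial ℝ n ν).eval x)
      (fun i _ => bernsteinPolynomial_eval_nonneg n i hx)
      (Finset.mem_range.2 (Nat.lt_succ_of_le hj))

theorem abs_iterate_derivative_bernsteinPolynomial_le (i n j : ℕ) {x : ℝ}
    (hx : x ∈ Icc (0 : ℝ) 1) :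
    |(derivative^[i] (bernsteinPolynomial ℝ n j)).eval x| ≤ (2 * n : ℝ) ^ i := by
  induction i generalizing n j with
  | zero =>
    simpa [abs_of_nonneg (bernsteinPolynomial_eval_nonneg n j hx)] using
      bernsteinPolynomial_eval_le_one n j hx
  | succ i ih =>
    have hmono (k : ℕ) :
        |(derivative^[i] (bernsteinPolynomial ℝ (n - 1) k)).eval x| ≤ (2 * n : ℝ) ^ i := by
      refine (ih (n - 1) k).trans ?_
      gcongr
      exact Nat.sub_le n 1
    have hn : (0 : ℝ) ≤ n := Nat.cast_nonneg n
    rw [Function.iterate_succ_apply, pow_succ]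
    cases j with
    | zero =>
      rw [bernsteinPolynomial.derivative_zero, neg_mul, iterate_derivative_neg,
        iterate_derivative_natCast_mul, eval_neg, abs_neg, eval_mul, eval_natCast, abs_mul,
        abs_of_nonneg hn]
      nlinarith [mul_le_mul_of_nonneg_left (hmono 0) hn,
        mul_nonneg hn (pow_nonneg (mul_nonneg zero_le_two hn) i)]
    | succ j =>
      rw [bernsteinPolynomial.derivative_succ, iterate_derivative_natCast_mul,
        iterate_derivative_sub, eval_mul, eval_natCast, eval_sub, abs_mul, abs_of_nonneg hn]
      have := (abs_sub _ _).trans (add_le_add (hmono j) (hmono (j + 1)))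
      nlinarith [mul_le_mul_of_nonneg_left this hn]

/-- The polynomial whose evaluation is `Bge n k`. -/
noncomputable def bgePoly (n k : ℕ) : ℝ[X] :=
  ∑ j ∈ Finset.Icc k n, bernsteinPolynomial ℝ n j

theorem eval_bgePoly (n k : ℕ) (x : ℝ) : (bgePoly n k).eval x = Bge n k x := by
  simp [bgePoly, Bge, bernsteinPolynomial, eval_finsetSum]

theorem bgePoly_zero_left {k : ℕ} (hk : 1 ≤ k) : bgePoly 0 k = 0 := by
  rw [bgePoly, Finset.Icc_eq_empty_of_lt (Nat.lt_of_succ_le hk), Finset.sum_empty]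

theorem abs_iterate_derivative_bgePoly_le (i n : ℕ) {k : ℕ} (hk : 1 ≤ k) {x : ℝ}
    (hx : x ∈ Icc (0 : ℝ) 1) :
    |(derivative^[i] (bgePoly n k)).eval x| ≤ 2 ^ i * (n : ℝ) ^ (i + 1) := by
  rw [bgePoly, iterate_derivative_sum, eval_finsetSum]
  calc _ ≤ ∑ j ∈ Finset.Icc k n, |(derivative^[i] (bernsteinPolynomial ℝ n j)).eval x| :=
        Finset.abs_sum_le_sum_abs _ _
    _ ≤ ∑ j ∈ Finset.Icc k n, (2 * n : ℝ) ^ i :=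
        Finset.sum_le_sum fun j _ => abs_iterate_derivative_bernsteinPolynomial_le i n j hx
    _ = ((n + 1 - k : ℕ) : ℝ) * (2 * n : ℝ) ^ i := by simp
    _ ≤ n * (2 * n : ℝ) ^ i := by
        gcongr
        omega
    _ = 2 ^ i * (n : ℝ) ^ (i + 1) := by ring

theorem bgePoly_one (n : ℕ) : bgePoly n 1 = 1 - (1 - X) ^ n := by
  have hsum := bernsteinPolynomial.sum ℝ n
  rw [Finset.range_eq_Ico, Finset.sum_eq_sum_Ico_succ_bot (Nat.succ_pos n)] at hsum
  have hzero : bernsteinPolynomial ℝ n 0 = (1 - X) ^ n := by simp [bernsteinPolynomial]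
  rw [eq_sub_iff_add_eq', ← hzero]
  exact hsum

theorem eval_derivative_bgePoly_one (n : ℕ) (x : ℝ) :
    (derivative^[1] (bgePoly n 1)).eval x = n * (1 - x) ^ (n - 1) := by
  simp [bgePoly_one, derivative_pow]

theorem eval_derivative_two_bgePoly_one (n : ℕ) (x : ℝ) :
    (derivative^[2] (bgePoly n 1)).eval x =
      -(n * (((n - 1 : ℕ) : ℝ) * (1 - x) ^ (n - 1 - 1))) := by
  simp [bgePoly_one, derivative_pow]

theorem iterate_derivative_bgePoly_zero {i k : ℕ} (n : ℕ) (hik : i < k) :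
    (derivative^[i] (bgePoly n k)).eval 0 = 0 := by
  rw [bgePoly, iterate_derivative_sum, eval_finsetSum]
  refine Finset.sum_eq_zero fun j hj => ?_
  exact bernsteinPolynomial.iterate_derivative_at_0_eq_zero_of_lt ℝ n
    (hik.trans_le (Finset.mem_Icc.1 hj).1)

/-- The second order Taylor bound for a polynomial on the unit interval. -/
theorem abs_eval_sub_sub_le (p : ℝ[X]) {K : ℝ}
    (hK : ∀ t ∈ Icc (0 : ℝ) 1, |(derivative (derivative p)).eval t| ≤ K) {x y : ℝ}
    (hx : x ∈ Icc (0 : ℝ) 1) (hy : y ∈ Icc (0 : ℝ) 1) :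
    |p.eval y - p.eval x - (y - x) * (derivative p).eval x| ≤ K * (y - x) ^ 2 := by
  have hK0 : 0 ≤ K := (abs_nonneg _).trans (hK x hx)
  have hsub : uIcc x y ⊆ Icc (0 : ℝ) 1 := ordConnected_Icc.uIcc_subset hx hy
  have hfirst (t : ℝ) (ht : t ∈ uIcc x y) :
      ‖(derivative p).eval t - (derivative p).eval x‖ ≤ K * |y - x| := by
    refine ((convex_Icc (0 : ℝ) 1).norm_image_sub_le_of_norm_hasDerivWithin_le
      (fun s _ => ((derivative p).hasDerivAt s).hasDerivWithinAt) hK hx (hsub ht)).trans ?_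
    exact mul_le_mul_of_nonneg_left (abs_sub_left_of_mem_uIcc ht) hK0
  have hder (t : ℝ) (_ : t ∈ uIcc x y) :
      HasDerivWithinAt (fun t => p.eval t - t * (derivative p).eval x)
        ((derivative p).eval t - (derivative p).eval x) (uIcc x y) t := by
    have hid := (hasDerivAt_id t).mul_const ((derivative p).eval x)
    rw [one_mul] at hid
    exact ((p.hasDerivAt t).sub hid).hasDerivWithinAt
  have hmain := (convex_uIcc x y).norm_image_sub_le_of_norm_hasDerivWithin_le hder hfirst
    left_mem_uIcc right_mem_uIcc
  rw [Real.norm_eq_abs, Real.norm_eq_abs, mul_assoc, ← sq, sq_abs] at hmain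
  convert hmain using 2
  ring

/-- All moments of `χ` converge. -/
def HasMoments (χ : ℕ → ℝ) : Prop := ∀ j : ℕ, Summable fun n => χ n * (n : ℝ) ^ j

/-- The termwise `i`-th derivative of `Psi χ h`. -/
noncomputable def psiDeriv (χ : ℕ → ℝ) (h : ℕ → ℕ) (i : ℕ) (x : ℝ) : ℝ :=
  ∑' n, χ n * (derivative^[i] (bgePoly n (h n))).eval x

theorem psiDeriv_zero (χ : ℕ → ℝ) (h : ℕ → ℕ) : psiDeriv χ h 0 = Psi χ h := by
  ext x
  simp [psiDeriv, Psi, eval_bgePoly]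

theorem HasMoments.abs {χ : ℕ → ℝ} (hχ : HasMoments χ) : HasMoments fun n => |χ n| := fun j => by
  simpa [abs_mul] using (hχ j).abs

theorem HasMoments.add {χ μ : ℕ → ℝ} (hχ : HasMoments χ) (hμ : HasMoments μ) :
    HasMoments (χ + μ) := fun j => by
  simpa [add_mul] using (hχ j).add (hμ j)

theorem HasMoments.smul {χ : ℕ → ℝ} (c : ℝ) (hχ : HasMoments χ) :
    HasMoments (c • χ) := fun j => by
  simpa [mul_assoc] using (hχ j).mul_left c

theorem HasMoments.single (N : ℕ) : HasMoments (Pi.single N 1) := fun j =>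
  summable_of_ne_finset_zero (s := {N}) fun n hn => by
    simp [Pi.single_eq_of_ne (Finset.notMem_singleton.1 hn)]

section Derivatives

variable {χ : ℕ → ℝ} {h : ℕ → ℕ}

theorem HasMoments.summable_bound (hχ : HasMoments χ) (i : ℕ) :
    Summable fun n => |χ n| * (2 ^ i * (n : ℝ) ^ (i + 1)) := by
  simpa [mul_left_comm] using (hχ.abs (i + 1)).mul_left (2 ^ i)

theorem summable_psiDeriv (hh : ∀ n, 1 ≤ h n) (hχ : HasMoments χ) (i : ℕ) {x : ℝ}
    (hx : x ∈ Icc (0 : ℝ) 1) :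
    Summable fun n => χ n * (derivative^[i] (bgePoly n (h n))).eval x := by
  refine Summable.of_norm_bounded (hχ.summable_bound i) fun n => ?_
  rw [Real.norm_eq_abs, abs_mul]
  exact mul_le_mul_of_nonneg_left (abs_iterate_derivative_bgePoly_le i n (hh n) hx) (abs_nonneg _)

theorem abs_psiDeriv_le (hh : ∀ n, 1 ≤ h n) (hχ : HasMoments χ) (i : ℕ) {x : ℝ}
    (hx : x ∈ Icc (0 : ℝ) 1) :
    |psiDeriv χ h i x| ≤ ∑' n, |χ n| * (2 ^ i * (n : ℝ) ^ (i + 1)) := by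
  refine tsum_of_norm_bounded (E := ℝ) (hχ.summable_bound i).hasSum fun n => ?_
  rw [Real.norm_eq_abs, abs_mul]
  exact mul_le_mul_of_nonneg_left (abs_iterate_derivative_bgePoly_le i n (hh n) hx) (abs_nonneg _)

theorem psiDeriv_add {μ : ℕ → ℝ} (hh : ∀ n, 1 ≤ h n) (hχ : HasMoments χ) (hμ : HasMoments μ)
    (i : ℕ) {x : ℝ} (hx : x ∈ Icc (0 : ℝ) 1) :
    psiDeriv (χ + μ) h i x = psiDeriv χ h i x + psiDeriv μ h i x := by
  simp only [psiDeriv, Pi.add_apply, add_mul]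
  exact (summable_psiDeriv hh hχ i hx).tsum_add (summable_psiDeriv hh hμ i hx)

theorem psiDeriv_smul (c : ℝ) (i : ℕ) (x : ℝ) :
    psiDeriv (c • χ) h i x = c * psiDeriv χ h i x := by
  simp only [psiDeriv, Pi.smul_apply, smul_eq_mul, mul_assoc, tsum_mul_left]

theorem psiDeriv_single (N i : ℕ) (x : ℝ) :
    psiDeriv (Pi.single N 1) h i x = (derivative^[i] (bgePoly N (h N))).eval x := by
  rw [psiDeriv, tsum_eq_single N fun n hn => by simp [Pi.single_eq_of_ne hn]]
  simp

theorem hasDerivWithinAt_psiDeriv (hh : ∀ n, 1 ≤ h n) (hχ : HasMoments χ) (i : ℕ) {x : ℝ}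
    (hx : x ∈ Icc (0 : ℝ) 1) :
    HasDerivWithinAt (psiDeriv χ h i) (psiDeriv χ h (i + 1) x) (Icc 0 1) x := by
  have hquad (y : ℝ) (hy : y ∈ Icc (0 : ℝ) 1) :
      |psiDeriv χ h i y - psiDeriv χ h i x - (y - x) * psiDeriv χ h (i + 1) x| ≤
        (∑' n, |χ n| * (2 ^ (i + 2) * (n : ℝ) ^ (i + 2 + 1))) * (y - x) ^ 2 := by
    have hsum := ((summable_psiDeriv hh hχ i hy).hasSum.sub
      (summable_psiDeriv hh hχ i hx).hasSum).sub
      ((summable_psiDeriv hh hχ (i + 1) hx).hasSum.mul_left (y - x))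
    have hbound := (hχ.summable_bound (i + 2)).hasSum.mul_right ((y - x) ^ 2)
    refine hsum.norm_le_of_bounded hbound fun n => ?_
    have htaylor := abs_eval_sub_sub_le (derivative^[i] (bgePoly n (h n)))
      (fun t ht => by
        simpa only [Function.iterate_succ_apply'] using
          abs_iterate_derivative_bgePoly_le (i + 2) n (hh n) ht) hx hy
    rw [← Function.iterate_succ_apply' (⇑derivative)] at htaylor
    calc _ = |χ n| * _ := by
          rw [Real.norm_eq_abs, ← abs_mul]
          congr 1
          ring
      _ ≤ _ := mul_le_mul_of_nonneg_left htaylor (abs_nonneg _)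
      _ = _ := by ring
  rw [hasDerivWithinAt_iff_isLittleO]
  refine (Asymptotics.IsBigO.of_bound (g := fun y : ℝ => (y - x) ^ 2)
    (∑' n, |χ n| * (2 ^ (i + 2) * (n : ℝ) ^ (i + 2 + 1))) ?_).trans_isLittleO ?_
  · filter_upwards [self_mem_nhdsWithin] with y hy
    simpa using hquad y hy
  · refine Asymptotics.IsLittleO.mono ?_ nhdsWithin_le_nhds
    simpa using Asymptotics.isLittleO_pow_sub_sub x one_lt_two

theorem continuousOn_psiDeriv (hh : ∀ n, 1 ≤ h n) (hχ : HasMoments χ) (i : ℕ) :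
    ContinuousOn (psiDeriv χ h i) (Icc 0 1) :=
  fun _ hx => (hasDerivWithinAt_psiDeriv hh hχ i hx).continuousWithinAt

theorem iteratedDerivWithin_Psi (hh : ∀ n, 1 ≤ h n) (hχ : HasMoments χ) (i : ℕ) {x : ℝ}
    (hx : x ∈ Icc (0 : ℝ) 1) :
    iteratedDerivWithin i (Psi χ h) (Icc 0 1) x = psiDeriv χ h i x := by
  induction i generalizing x with
  | zero => rw [iteratedDerivWithin_zero, psiDeriv_zero]
  | succ i ih =>
    rw [iteratedDerivWithin_succ, derivWithin_congr (fun y hy => ih hy) (ih hx)]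
    exact (hasDerivWithinAt_psiDeriv hh hχ i hx).derivWithin (uniqueDiffOn_Icc zero_lt_one x hx)

theorem exists_psiDeriv_eq_slope (hh : ∀ n, 1 ≤ h n) (hχ : HasMoments χ) (i : ℕ) {a b : ℝ}
    (ha : 0 ≤ a) (hab : a < b) (hb : b ≤ 1) :
    ∃ c ∈ Ioo a b, psiDeriv χ h (i + 1) c =
      (psiDeriv χ h i b - psiDeriv χ h i a) / (b - a) := by
  refine exists_hasDerivAt_eq_slope _ _ hab
    ((continuousOn_psiDeriv hh hχ i).mono (Icc_subset_Icc ha hb)) fun x hx => ?_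
  exact (hasDerivWithinAt_psiDeriv hh hχ i ⟨ha.trans hx.1.le, hx.2.le.trans hb⟩).hasDerivAt
    (Icc_mem_nhds (ha.trans_lt hx.1) (hx.2.trans_le hb))

theorem psiDeriv_zero_zero (hh : ∀ n, 1 ≤ h n) : psiDeriv χ h 0 0 = 0 := by
  simp only [psiDeriv, iterate_derivative_bgePoly_zero _ (hh _), mul_zero, tsum_zero]

end Derivatives

section Limits

variable {χ : ℕ → ℝ} {h : ℕ → ℕ}

theorem tendsto_psiDeriv (hh : ∀ n, 1 ≤ h n) (hχ : HasMoments χ) {χs : ℕ → ℕ → ℝ}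
    (hχs : ∀ j, HasMoments (χs j))
    (hconv : ∀ p : ℕ, Tendsto
      (fun j => ∑' k : ℕ, ((k : ℝ) + 1) ^ p * |χs j (k + 1) - χ (k + 1)|) atTop (𝓝 0))
    {y : ℕ → ℝ} (hy : ∀ j, y j ∈ Icc (0 : ℝ) 1) (hy0 : Tendsto y atTop (𝓝 0)) (i : ℕ) :
    Tendsto (fun j => psiDeriv (χs j) h i (y j)) atTop (𝓝 (psiDeriv χ h i 0)) := by
  have hdiff (j : ℕ) : HasMoments (χs j + (-1 : ℝ) • χ) := (hχs j).add (hχ.smul (-1))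
  have hsmall : Tendsto (fun j => psiDeriv (χs j + (-1 : ℝ) • χ) h i (y j)) atTop (𝓝 0) := by
    refine squeeze_zero_norm (fun j => ?_) (by simpa using (hconv (i + 1)).const_mul (2 ^ i))
    refine (abs_psiDeriv_le hh (hdiff j) i (hy j)).trans (le_of_eq ?_)
    rw [((hdiff j).summable_bound i).tsum_eq_zero_add, ← tsum_mul_left]
    simp only [Nat.cast_zero, ne_eq, Nat.add_eq_zero_iff, one_ne_zero, and_false,
      not_false_eq_true, zero_pow, mul_zero, zero_add, Pi.add_apply, Pi.smul_apply, smul_eq_mul,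
      neg_mul, one_mul, ← sub_eq_add_neg, Nat.cast_add, Nat.cast_one]
    exact tsum_congr fun k => by ring
  have hlim : Tendsto (fun j => psiDeriv χ h i (y j)) atTop (𝓝 (psiDeriv χ h i 0)) :=
    (continuousOn_psiDeriv hh hχ i 0 (by simp)).tendsto.comp
      (tendsto_nhdsWithin_iff.2 ⟨hy0, Eventually.of_forall hy⟩)
  have hadd := hlim.add hsmall
  rw [add_zero] at hadd
  refine hadd.congr fun j => ?_
  rw [psiDeriv_add hh (hχs j) (hχ.smul (-1)) i (hy j), psiDeriv_smul]
  ring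

theorem psiDeriv_at_zero_of_approx (hh : ∀ n, 1 ≤ h n) (hχ : HasMoments χ) {χs : ℕ → ℕ → ℝ}
    (hχs : ∀ j, HasMoments (χs j))
    (hconv : ∀ p : ℕ, Tendsto
      (fun j => ∑' k : ℕ, ((k : ℝ) + 1) ^ p * |χs j (k + 1) - χ (k + 1)|) atTop (𝓝 0))
    {x : ℕ → ℝ} (hx : ∀ j, x j ∈ Ioo (0 : ℝ) 1) (hfix : ∀ j, psiDeriv (χs j) h 0 (x j) = x j)
    (hle : ∀ j, psiDeriv (χs j) h 1 (x j) ≤ 1) (hx0 : Tendsto x atTop (𝓝 0)) :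
    psiDeriv χ h 1 0 = 1 ∧ psiDeriv χ h 2 0 ≤ 0 := by
  have hfirst (j : ℕ) : ∃ c ∈ Ioo 0 (x j), psiDeriv (χs j) h 1 c = 1 := by
    obtain ⟨c, hc, hslope⟩ := exists_psiDeriv_eq_slope hh (hχs j) 0 le_rfl (hx j).1 (hx j).2.le
    refine ⟨c, hc, ?_⟩
    rw [hslope, hfix, psiDeriv_zero_zero hh, div_self]
    simpa using (hx j).1.ne'
  choose c hc hc1 using hfirst
  have hsecond (j : ℕ) : ∃ d ∈ Ioo (c j) (x j), psiDeriv (χs j) h 2 d ≤ 0 := by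
    obtain ⟨d, hd, hslope⟩ :=
      exists_psiDeriv_eq_slope hh (hχs j) 1 (hc j).1.le (hc j).2 (hx j).2.le
    refine ⟨d, hd, ?_⟩
    rw [hslope, hc1]
    exact div_nonpos_of_nonpos_of_nonneg (sub_nonpos.2 (hle j)) (sub_nonneg.2 (hc j).2.le)
  choose d hd hd2 using hsecond
  have hd0 (j : ℕ) : 0 < d j := (hc j).1.trans (hd j).1
  have hclim : Tendsto c atTop (𝓝 0) :=
    squeeze_zero (fun j => (hc j).1.le) (fun j => (hc j).2.le) hx0
  have hdlim : Tendsto d atTop (𝓝 0) :=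
    squeeze_zero (fun j => (hd0 j).le) (fun j => (hd j).2.le) hx0
  constructor
  · refine tendsto_nhds_unique (tendsto_psiDeriv hh hχ hχs hconv
      (fun j => ⟨(hc j).1.le, ((hc j).2.trans (hx j).2).le⟩) hclim 1) ?_
    simp [hc1]
  · exact le_of_tendsto' (tendsto_psiDeriv hh hχ hχs hconv
      (fun j => ⟨(hd0 j).le, ((hd j).2.trans (hx j).2).le⟩) hdlim 2) hd2

end Limits

theorem eventually_pos_of_hasDerivWithinAt {f : ℝ → ℝ} {d : ℝ}
    (hf : HasDerivWithinAt f d (Icc 0 1) 0) (hf0 : f 0 = 0) (hd : 0 < d) :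
    ∀ᶠ x in 𝓝[>] (0 : ℝ), 0 < f x := by
  have hslope := (hasDerivWithinAt_iff_tendsto_slope' (by simp)).1
    (hf.mono (Ioo_subset_Icc_self (a := (0 : ℝ)) (b := 1)))
  rw [nhdsWithin_Ioo_eq_nhdsGT zero_lt_one] at hslope
  filter_upwards [hslope.eventually (lt_mem_nhds hd), self_mem_nhdsWithin] with x hx hx0
  rw [slope_def_field, hf0, sub_zero, sub_zero] at hx
  exact (div_pos_iff_of_pos_right hx0).1 hx

section Perturbation

variable {χ : ℕ → ℝ} {h : ℕ → ℕ}

theorem psiDeriv_mixture (hh : ∀ n, 1 ≤ h n) (hχ : HasMoments χ) (ε : ℝ) (N i : ℕ) {x : ℝ}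
    (hx : x ∈ Icc (0 : ℝ) 1) :
    psiDeriv ((1 - ε) • χ + ε • Pi.single N 1) h i x =
      (1 - ε) * psiDeriv χ h i x + ε * psiDeriv (Pi.single N 1) h i x := by
  rw [psiDeriv_add hh (hχ.smul _) ((HasMoments.single N).smul _) i hx, psiDeriv_smul,
    psiDeriv_smul]

/-- If `Ψ'(0) = 1` and `Ψ''(0) < 0`, mixing in a small point mass at some `N ≥ 2` with threshold one
creates a small fixed point at which the derivative is at most one. -/
theorem exists_mixture_fixedPoint (hh : ∀ n, 1 ≤ h n) (hχ : HasMoments χ)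
    (h1 : psiDeriv χ h 1 0 = 1) (h2 : psiDeriv χ h 2 0 < 0) {N : ℕ} (hN : 2 ≤ N) (hhN : h N = 1)
    {η : ℝ} (hη : 0 < η) (hη1 : η ≤ 1) :
    ∃ ε ∈ Icc 0 η, ∃ x ∈ Ioo 0 η,
      psiDeriv ((1 - ε) • χ + ε • Pi.single N 1) h 0 x = x ∧
      psiDeriv ((1 - ε) • χ + ε • Pi.single N 1) h 1 x ≤ 1 := by
  have hzero : (0 : ℝ) ∈ Icc (0 : ℝ) 1 := by simp
  have hNm : HasMoments (Pi.single N 1) := HasMoments.single N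
  have hNcast : (2 : ℝ) ≤ N := by exact_mod_cast hN
  have hN1 : psiDeriv (Pi.single N 1) h 1 0 = N := by
    rw [psiDeriv_single, hhN, eval_derivative_bgePoly_one]
    simp
  have hN2 (t : ℝ) (ht : t ∈ Icc (0 : ℝ) 1) : psiDeriv (Pi.single N 1) h 2 t ≤ 0 := by
    rw [psiDeriv_single, hhN, eval_derivative_two_bgePoly_one]
    have : 0 ≤ 1 - t := sub_nonneg.2 ht.2
    exact neg_nonpos.2 (by positivity)
  obtain ⟨r, hr, hneg⟩ : ∃ r > 0, ∀ t ∈ Icc (0 : ℝ) 1, t < r → psiDeriv χ h 2 t < 0 := by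
    obtain ⟨r, hr, hball⟩ := Metric.mem_nhdsWithin_iff.1
      ((continuousOn_psiDeriv hh hχ 2 0 hzero).tendsto.eventually (gt_mem_nhds h2))
    refine ⟨r, hr, fun t ht htr => hball ⟨?_, ht⟩⟩
    rwa [Metric.mem_ball, Real.dist_eq, sub_zero, abs_of_nonneg ht.1]
  have hgd := hasDerivWithinAt_psiDeriv hh hNm 0 hzero
  have hfd := hasDerivWithinAt_psiDeriv hh hχ 0 hzero
  have hid := hasDerivWithinAt_id (0 : ℝ) (Icc 0 1)
  rw [zero_add, hN1] at hgd
  rw [zero_add, h1] at hfd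
  have hgpos := eventually_pos_of_hasDerivWithinAt (hgd.sub hid)
    (by simp [psiDeriv_zero_zero hh]) (by linarith)
  have hkpos := eventually_pos_of_hasDerivWithinAt (((hgd.sub hid).const_mul η).sub (hid.sub hfd))
    (by simp [psiDeriv_zero_zero hh]) (by nlinarith)
  obtain ⟨x, hgx, hkx, hx0, hxlt⟩ :=
    (hgpos.and (hkpos.and (Ioo_mem_nhdsGT (lt_min hη hr)))).exists
  simp only [Pi.sub_apply, id_eq] at hgx hkx
  have hxη : x < η := hxlt.trans_le (min_le_left _ _)
  have hxr : x < r := hxlt.trans_le (min_le_right _ _)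
  have hx1 : x ≤ 1 := hxη.le.trans hη1
  have hfx : psiDeriv χ h 0 x < x := by
    obtain ⟨c, hc, hcs⟩ := exists_psiDeriv_eq_slope hh hχ 0 le_rfl hx0 hx1
    obtain ⟨d, hd, hds⟩ := exists_psiDeriv_eq_slope hh hχ 1 le_rfl hc.1 (hc.2.le.trans hx1)
    have hdneg := hneg d ⟨hd.1.le, (hd.2.trans hc.2).le.trans hx1⟩ ((hd.2.trans hc.2).trans hxr)
    rw [zero_add] at hcs
    rw [hds, h1, sub_zero, div_lt_iff₀ hc.1, zero_mul, sub_neg, hcs,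
      psiDeriv_zero_zero hh, sub_zero, sub_zero, div_lt_one hx0] at hdneg
    exact hdneg
  set f := psiDeriv χ h 0 x
  set g := psiDeriv (Pi.single N 1) h 0 x
  have hgf : 0 < g - f := by linarith
  have hε0 : 0 ≤ (x - f) / (g - f) := div_nonneg (by linarith) hgf.le
  have hεη : (x - f) / (g - f) ≤ η := by
    rw [div_le_iff₀ hgf]
    nlinarith
  have hfix : psiDeriv ((1 - (x - f) / (g - f)) • χ + ((x - f) / (g - f)) • Pi.single N 1) h 0 x
      = x := by
    rw [psiDeriv_mixture hh hχ _ N 0 ⟨hx0.le, hx1⟩]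
    change (1 - (x - f) / (g - f)) * f + (x - f) / (g - f) * g = x
    field_simp
    ring
  refine ⟨(x - f) / (g - f), ⟨hε0, hεη⟩, x, ⟨hx0, hxη⟩, hfix, ?_⟩
  have hmix : HasMoments ((1 - (x - f) / (g - f)) • χ + ((x - f) / (g - f)) • Pi.single N 1) :=
    (hχ.smul _).add (hNm.smul _)
  obtain ⟨c, hc, hcs⟩ := exists_psiDeriv_eq_slope hh hmix 0 le_rfl hx0 hx1
  obtain ⟨d, hd, hds⟩ := exists_psiDeriv_eq_slope hh hmix 1 hc.1.le hc.2 hx1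
  rw [hfix, psiDeriv_zero_zero hh, div_self (by simpa using hx0.ne'), zero_add] at hcs
  have hd01 : d ∈ Icc (0 : ℝ) 1 := ⟨(hc.1.trans hd.1).le, hd.2.le.trans hx1⟩
  rw [psiDeriv_mixture hh hχ _ N _ hd01, hcs, eq_div_iff (sub_pos.2 hc.2).ne'] at hds
  have hd2 := hneg d hd01 (hd.2.trans hxr)
  have hnonpos : (1 - (x - f) / (g - f)) * psiDeriv χ h (1 + 1) d +
      (x - f) / (g - f) * psiDeriv (Pi.single N 1) h (1 + 1) d ≤ 0 :=
    add_nonpos (mul_nonpos_of_nonneg_of_nonpos (by linarith) hd2.le)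
      (mul_nonpos_of_nonneg_of_nonpos hε0 (hN2 d hd01))
  have := mul_nonpos_of_nonpos_of_nonneg hnonpos (sub_pos.2 hc.2).le
  linarith

theorem exists_threshold_one (hh : ∀ n, 1 ≤ h n) (hχ : IsChildDist χ)
    (hsupp : ∃ a b : ℕ, a ≠ b ∧ 0 < χ a ∧ 0 < χ b) (h1 : psiDeriv χ h 1 0 = 1) :
    ∃ N, 2 ≤ N ∧ h N = 1 ∧ 0 < χ N := by
  obtain ⟨hnonneg, hsum, htot⟩ := hχ
  by_contra! hcon
  have hterm (n : ℕ) (hn : n ≠ 1) : χ n * (derivative^[1] (bgePoly n (h n))).eval 0 = 0 := by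
    rcases (hh n).lt_or_eq with hlt | heq
    · rw [iterate_derivative_bgePoly_zero n hlt, mul_zero]
    · rw [← heq, eval_derivative_bgePoly_one]
      rcases Nat.eq_zero_or_pos n with rfl | hpos
      · simp
      · rw [le_antisymm (hcon n (by omega) heq.symm) (hnonneg n), zero_mul]
  rw [psiDeriv, tsum_eq_single 1 hterm] at h1
  have hone : χ 1 = 1 := by
    rcases (hh 1).lt_or_eq with hlt | heq
    · rw [iterate_derivative_bgePoly_zero 1 hlt, mul_zero] at h1
      exact absurd h1 zero_ne_one
    · rw [← heq, eval_derivative_bgePoly_one] at h1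
      simpa using h1
  have hother (n : ℕ) (hn : n ≠ 1) : χ n ≤ 0 := by
    have hpair := hsum.sum_le_tsum {1, n} fun i _ => hnonneg i
    rw [htot, Finset.sum_pair hn.symm, hone] at hpair
    linarith
  obtain ⟨a, b, hab, ha, hb⟩ := hsupp
  rcases eq_or_ne a 1 with rfl | ha1
  · exact (hother b hab.symm).not_gt hb
  · exact (hother a ha1).not_gt ha

theorem exists_convex_term (hh : ∀ n, 1 ≤ h n) (hχ : IsChildDist χ) (hmom : HasMoments χ)
    {N : ℕ} (hN : 2 ≤ N) (hhN : h N = 1) (hχN : 0 < χ N) (h2 : psiDeriv χ h 2 0 = 0) :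
    ∃ M, 0 < χ M ∧ 0 < (derivative^[2] (bgePoly M (h M))).eval 0 := by
  by_contra! hcon
  have hle (n : ℕ) : χ n * (derivative^[2] (bgePoly n (h n))).eval 0 ≤ 0 := by
    rcases (hχ.1 n).lt_or_eq with hlt | heq
    · exact mul_nonpos_of_nonneg_of_nonpos hlt.le (hcon n hlt)
    · simp [← heq]
  have hlt : χ N * (derivative^[2] (bgePoly N (h N))).eval 0 < 0 := by
    rw [hhN, eval_derivative_two_bgePoly_one]
    have hN0 : (0 : ℝ) < N := by exact_mod_cast (by omega : 0 < N)
    have hN1 : (0 : ℝ) < ((N - 1 : ℕ) : ℝ) := by exact_mod_cast (by omega : 0 < N - 1)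
    have : 0 < χ N * (N * ((N - 1 : ℕ) : ℝ)) := by positivity
    simpa using this
  have := (summable_psiDeriv hh hmom 2 (by simp)).tsum_lt_tsum (g := fun _ => (0 : ℝ))
    hle hlt summable_zero
  rw [tsum_zero] at this
  exact this.ne h2

/-- Moving mass from a point where the threshold polynomial is convex at `0` to the point `0`
makes the second derivative negative without changing the first one. -/
theorem exists_strict_perturbation (hh : ∀ n, 1 ≤ h n) (hχ : IsChildDist χ) (hmom : HasMoments χ)
    (h1 : psiDeriv χ h 1 0 = 1) (h2 : psiDeriv χ h 2 0 ≤ 0)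
    {N : ℕ} (hN : 2 ≤ N) (hhN : h N = 1) (hχN : 0 < χ N) :
    ∃ w : ℕ → ℝ, HasMoments w ∧ (∀ n, 0 ≤ w n) ∧ ∀ η : ℝ, 0 < η → ∃ μ : ℕ → ℝ,
      IsChildDist μ ∧ HasMoments μ ∧ (∀ n, |μ n - χ n| ≤ η * w n) ∧
      psiDeriv μ h 1 0 = 1 ∧ psiDeriv μ h 2 0 < 0 := by
  rcases h2.lt_or_eq with hlt | heq
  · exact ⟨0, fun j => by simp, fun n => le_rfl,
      fun η _ => ⟨χ, hχ, hmom, by simp, h1, hlt⟩⟩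
  obtain ⟨M, hχM, hM2⟩ := exists_convex_term hh hχ hmom hN hhN hχN heq
  have hhM : 1 < h M := by
    refine (hh M).lt_of_ne fun hM => hM2.not_ge ?_
    rw [← hM, eval_derivative_two_bgePoly_one]
    have : (0 : ℝ) ≤ M * (((M - 1 : ℕ) : ℝ) * (1 - 0) ^ (M - 1 - 1)) := by
      rw [sub_zero]
      positivity
    linarith
  have hzero : (0 : ℝ) ∈ Icc (0 : ℝ) 1 := by simp
  refine ⟨Pi.single 0 1 + Pi.single M 1, (HasMoments.single 0).add (HasMoments.single M),
    fun n => ?_, fun η hη => ?_⟩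
  · have : (0 : ℕ → ℝ) ≤ Pi.single 0 1 + Pi.single M 1 :=
      add_nonneg (Pi.single_nonneg.2 zero_le_one) (Pi.single_nonneg.2 zero_le_one)
    exact this n
  obtain ⟨δ, hδ, hδη, hδM⟩ : ∃ δ > 0, δ ≤ η ∧ δ ≤ χ M :=
    ⟨min η (χ M), lt_min hη hχM, min_le_left _ _, min_le_right _ _⟩
  have hderiv (i : ℕ) : psiDeriv (χ + (δ • Pi.single 0 1 + (-δ) • Pi.single M 1)) h i 0 =
      psiDeriv χ h i 0 - δ * (derivative^[i] (bgePoly M (h M))).eval 0 := by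
    rw [psiDeriv_add hh hmom
        (((HasMoments.single 0).smul δ).add ((HasMoments.single M).smul (-δ))) i hzero,
      psiDeriv_add hh ((HasMoments.single 0).smul δ) ((HasMoments.single M).smul (-δ)) i hzero,
      psiDeriv_smul, psiDeriv_smul, psiDeriv_single, psiDeriv_single]
    simp [bgePoly_zero_left (hh 0), sub_eq_add_neg]
  refine ⟨χ + (δ • Pi.single 0 1 + (-δ) • Pi.single M 1), ⟨fun n => ?_, ?_⟩,
    hmom.add (((HasMoments.single 0).smul δ).add ((HasMoments.single M).smul (-δ))),
    fun n => ?_, ?_, ?_⟩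
  · simp only [Pi.add_apply, Pi.smul_apply, smul_eq_mul, Pi.single_apply]
    have := hχ.1 n
    split_ifs with hn0 hnM hnM
    · linarith
    · linarith
    · subst hnM
      linarith
    · linarith
  · have hsum := (hχ.2.1.hasSum.add (((hasSum_pi_single 0 (1 : ℝ)).mul_left δ).add
      ((hasSum_pi_single M (1 : ℝ)).mul_left (-δ))))
    rw [hχ.2.2] at hsum
    exact ⟨hsum.summable, hsum.tsum_eq.trans (by ring)⟩
  · simp only [Pi.add_apply, Pi.smul_apply, smul_eq_mul, Pi.single_apply, add_sub_cancel_left]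
    rw [abs_le]
    split_ifs <;> constructor <;> linarith
  · rw [hderiv, h1, iterate_derivative_bgePoly_zero M hhM, mul_zero, sub_zero]
  · rw [hderiv, heq, zero_sub]
    exact neg_neg_of_pos (mul_pos hδ hM2)

theorem IsChildDist.mixture (hχ : IsChildDist χ) {ε : ℝ} (hε : ε ∈ Icc (0 : ℝ) 1) (N : ℕ) :
    IsChildDist ((1 - ε) • χ + ε • Pi.single N 1) := by
  have hsum := (hχ.2.1.hasSum.mul_left (1 - ε)).add ((hasSum_pi_single N (1 : ℝ)).mul_left ε)
  rw [hχ.2.2] at hsum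
  refine ⟨fun n => ?_, hsum.summable, hsum.tsum_eq.trans (by ring)⟩
  have hsingle : (0 : ℕ → ℝ) ≤ Pi.single N 1 := Pi.single_nonneg.2 zero_le_one
  exact add_nonneg (mul_nonneg (sub_nonneg.2 hε.2) (hχ.1 n)) (mul_nonneg hε.1 (hsingle n))

/-- Arbitrarily small perturbations of `χ`, measured by a fixed weight with all moments, that have
small fixed points with derivative at most one. -/
theorem exists_small_perturbation (hh : ∀ n, 1 ≤ h n) (hχ : IsChildDist χ) (hmom : HasMoments χ)
    (hsupp : ∃ a b : ℕ, a ≠ b ∧ 0 < χ a ∧ 0 < χ b)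
    (h1 : psiDeriv χ h 1 0 = 1) (h2 : psiDeriv χ h 2 0 ≤ 0) :
    ∃ w : ℕ → ℝ, HasMoments w ∧ ∀ η : ℝ, 0 < η → η ≤ 1 → ∃ (μ : ℕ → ℝ) (x : ℝ),
      IsChildDist μ ∧ HasMoments μ ∧ (∀ n, |μ n - χ n| ≤ η * w n) ∧
      x ∈ Ioo 0 η ∧ psiDeriv μ h 0 x = x ∧ psiDeriv μ h 1 x ≤ 1 := by
  obtain ⟨N, hN, hhN, hχN⟩ := exists_threshold_one hh hχ hsupp h1
  obtain ⟨w, hw, hw0, hpert⟩ := exists_strict_perturbation hh hχ hmom h1 h2 hN hhN hχN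
  refine ⟨w + (w + (χ + Pi.single N 1)), hw.add (hw.add (hmom.add (HasMoments.single N))),
    fun η hη hη1 => ?_⟩
  obtain ⟨μ, hμ, hμmom, hμχ, hμ1, hμ2⟩ := hpert η hη
  obtain ⟨ε, hε, x, hx, hfix, hder⟩ := exists_mixture_fixedPoint hh hμmom hμ1 hμ2 hN hhN hη hη1
  refine ⟨(1 - ε) • μ + ε • Pi.single N 1, x, hμ.mixture ⟨hε.1, hε.2.trans hη1⟩ N,
    (hμmom.smul _).add ((HasMoments.single N).smul _), fun n => ?_, hx, hfix, hder⟩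
  have hsingle : (0 : ℕ → ℝ) ≤ Pi.single N 1 := Pi.single_nonneg.2 zero_le_one
  have hs := hsingle n
  simp only [Pi.add_apply, Pi.smul_apply, smul_eq_mul, Pi.zero_apply] at hs ⊢
  set s : ℝ := (Pi.single N 1 : ℕ → ℝ) n
  have hμn := hμ.1 n
  have hμle : μ n ≤ χ n + w n := by
    have := (abs_le.1 (hμχ n)).2
    nlinarith [hw0 n]
  have hdiff : |ε * (s - μ n)| ≤ η * (w n + (χ n + s)) := by
    rw [abs_mul, abs_of_nonneg hε.1]
    refine mul_le_mul hε.2 ?_ (abs_nonneg _) hη.le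
    rw [abs_le]
    have := hχ.1 n
    have := hw0 n
    constructor <;> linarith
  calc |(1 - ε) * μ n + ε * s - χ n| = |(μ n - χ n) + ε * (s - μ n)| := by
        congr 1
        ring
    _ ≤ |μ n - χ n| + |ε * (s - μ n)| := abs_add_le _ _
    _ ≤ η * w n + η * (w n + (χ n + s)) := add_le_add (hμχ n) hdiff
    _ = η * (w n + (w n + (χ n + s))) := by ring

theorem tendsto_tsum_of_abs_sub_le {χs : ℕ → ℕ → ℝ} {w : ℕ → ℝ} (hw : HasMoments w)
    {η : ℕ → ℝ} (hη : Tendsto η atTop (𝓝 0)) (hle : ∀ j n, |χs j n - χ n| ≤ η j * w n) (p : ℕ) :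
    Tendsto (fun j => ∑' k : ℕ, ((k : ℝ) + 1) ^ p * |χs j (k + 1) - χ (k + 1)|)
      atTop (𝓝 0) := by
  have hsum : Summable fun k : ℕ => w (k + 1) * ((k : ℝ) + 1) ^ p := by
    simpa using (summable_nat_add_iff 1).2 (hw p)
  have hterm (j k : ℕ) : ((k : ℝ) + 1) ^ p * |χs j (k + 1) - χ (k + 1)| ≤
      η j * (w (k + 1) * ((k : ℝ) + 1) ^ p) := by
    have := mul_le_mul_of_nonneg_left (hle j (k + 1)) (by positivity : 0 ≤ ((k : ℝ) + 1) ^ p)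
    linarith
  have hnonneg (j k : ℕ) : 0 ≤ ((k : ℝ) + 1) ^ p * |χs j (k + 1) - χ (k + 1)| := by positivity
  refine squeeze_zero (fun j => tsum_nonneg (hnonneg j)) (fun j => ?_)
    (by simpa using hη.mul_const (∑' k : ℕ, w (k + 1) * ((k : ℝ) + 1) ^ p))
  have hsumj := hsum.mul_left (η j)
  rw [← tsum_mul_left]
  exact (Summable.of_nonneg_of_le (hnonneg j) (hterm j) hsumj).tsum_le_tsum (hterm j) hsumj

end Perturbation

theorem stmt18 (χ : ℕ → ℝ) (h : ℕ → ℕ)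
    (hχ : IsChildDist χ)
    (hmom : ∀ j : ℕ, Summable fun n => χ n * (n : ℝ) ^ j)
    (hsupp : ∃ a b : ℕ, a ≠ b ∧ 0 < χ a ∧ 0 < χ b)
    (hh : ∀ n, 1 ≤ h n) :
    (iteratedDerivWithin 1 (Psi χ h) (Set.Icc (0 : ℝ) 1) 0 = 1 ∧
      iteratedDerivWithin 2 (Psi χ h) (Set.Icc (0 : ℝ) 1) 0 ≤ 0) ↔
    (∃ (χs : ℕ → ℕ → ℝ) (x : ℕ → ℝ),
      (∀ j, IsChildDist (χs j)) ∧
      (∀ j, ∀ p : ℕ, Summable fun n => χs j n * (n : ℝ) ^ p) ∧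
      (∀ p : ℕ, Filter.Tendsto
        (fun j => ∑' k : ℕ, ((k : ℝ) + 1) ^ p * |χs j (k + 1) - χ (k + 1)|)
        Filter.atTop (nhds 0)) ∧
      (∀ j, x j ∈ Set.Ioo (0 : ℝ) 1 ∧ Psi (χs j) h (x j) = x j ∧
        iteratedDerivWithin 1 (Psi (χs j) h) (Set.Icc (0 : ℝ) 1) (x j) ≤ 1) ∧
      Filter.Tendsto x Filter.atTop (nhds 0)) := by
  have hmom' : HasMoments χ := hmom
  have hzero : (0 : ℝ) ∈ Set.Icc (0 : ℝ) 1 := by simp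
  rw [iteratedDerivWithin_Psi hh hmom' 1 hzero, iteratedDerivWithin_Psi hh hmom' 2 hzero]
  constructor
  · rintro ⟨h1, h2⟩
    obtain ⟨w, hw, hpert⟩ := exists_small_perturbation hh hχ hmom' hsupp h1 h2
    have hη0 (j : ℕ) : (0 : ℝ) < 1 / ((j : ℝ) + 1) := by positivity
    have hη1 (j : ℕ) : 1 / ((j : ℝ) + 1) ≤ 1 := by
      rw [div_le_one (by positivity)]
      linarith [Nat.cast_nonneg (α := ℝ) j]
    choose χs x hdist hmoms hclose hx hfix hder using fun j : ℕ => hpert _ (hη0 j) (hη1 j)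
    have hηlim := tendsto_one_div_add_atTop_nhds_zero_nat (𝕜 := ℝ)
    have hx01 (j : ℕ) : x j ∈ Set.Ioo (0 : ℝ) 1 := ⟨(hx j).1, (hx j).2.trans_le (hη1 j)⟩
    refine ⟨χs, x, hdist, hmoms, tendsto_tsum_of_abs_sub_le hw hηlim hclose, fun j => ?_,
      squeeze_zero (fun j => (hx j).1.le) (fun j => (hx j).2.le) hηlim⟩
    refine ⟨hx01 j, ?_, ?_⟩
    · rw [← psiDeriv_zero, hfix]
    · rw [iteratedDerivWithin_Psi hh (hmoms j) 1 (Set.Ioo_subset_Icc_self (hx01 j))]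
      exact hder j
  · rintro ⟨χs, x, -, hmoms, hconv, hx, hx0⟩
    refine psiDeriv_at_zero_of_approx hh hmom' hmoms hconv (fun j => (hx j).1) (fun j => ?_)
      (fun j => ?_) hx0
    · rw [psiDeriv_zero, (hx j).2.1]
    · rw [← iteratedDerivWithin_Psi hh (hmoms j) 1 (Set.Ioo_subset_Icc_self (hx j).1)]
      exact (hx j).2.2
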